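/- In the setting of the single-robot transect value functions (same definitions of Ṽ_i, V*_i, Δ, ε_i), call π̃ = (π̃_0, …, π̃_t) a Markov-optimal policy if each π̃_i maps every column-i location u to some m ∈ {1,…,r} attaining the maximum in the recursion defining Ṽ_i(u). For such π̃, define its non-Markovian value on a history x_{0:i} by V^{π̃}_t(x_{0:t}) = ½·log(2πe·σ²_{loc(t+1,π̃_t(x_t))|x_{0:t}}) and, for 0 ≤ i < t, V^{π̃}_i(x_{0:i}) = ½·log(2πe·σ²_{x_{i+1}|x_{0:i}}) + V^{π̃}_{i+1}((x_{0:i}, x_{i+1})) with x_{i+1} = loc(i+1, π̃_i(x_i)). If ξ < ρ/t and ξ⁴ < (ρ/t − ξ)(ρ − ξ²), then for every column-0 location x_0: V*_0(x_0) − V^{π̃}_0(x_0) ≤ ε_0 = Σ_{s=0}^{t} Δ(s); that is, the Markov-based policy π̃ is ε_0-optimal for the maximum-entropy criterion. -/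

import Mathlib

open Real

/-- Squared exponential covariance function on ℝ². -/
noncomputable def seCov (σs σn ℓ₁ ℓ₂ : ℝ) (u v : ℝ × ℝ) : ℝ :=
  σs ^ 2 * Real.exp (-((u.1 - v.1) ^ 2) / (2 * ℓ₁ ^ 2) - (u.2 - v.2) ^ 2 / (2 * ℓ₂ ^ 2)) +
    σn ^ 2 * (if u = v then 1 else 0)

/-- Kernel (covariance) matrix of a finite tuple of locations. -/
noncomputable def kerMat (σs σn ℓ₁ ℓ₂ : ℝ) {ι : Type} [Fintype ι]
    (x : ι → ℝ × ℝ) : Matrix ι ι ℝ :=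
  Matrix.of fun j k => seCov σs σn ℓ₁ ℓ₂ (x j) (x k)

/-- Posterior (conditional) variance σ²_{u|x} = σ(u,u) − Σ_{uX} Σ_{XX}⁻¹ Σ_{Xu}. -/
noncomputable def postVar (σs σn ℓ₁ ℓ₂ : ℝ) (u : ℝ × ℝ) {ι : Type} [Fintype ι] [DecidableEq ι]
    (x : ι → ℝ × ℝ) : ℝ :=
  seCov σs σn ℓ₁ ℓ₂ u u -
    ∑ j, ∑ k, seCov σs σn ℓ₁ ℓ₂ u (x j) * (kerMat σs σn ℓ₁ ℓ₂ x)⁻¹ j k *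
      seCov σs σn ℓ₁ ℓ₂ (x k) u

/-- The per-stage bound Δ(i) on the Gaussian conditional mutual information (Δ(0) = 0). -/
noncomputable def Del (ξ ρ : ℝ) (i : ℕ) : ℝ :=
  if i = 0 then 0
  else (1 / 2) * Real.log (1 - ξ ^ 4 / ((ρ / (i : ℝ) - ξ) * (ρ - ξ ^ 2)))⁻¹

/-- Stagewise Gaussian posterior entropy ½·log(2πe·σ²_{u|x}). -/
noncomputable def ent (σs σn ℓ₁ ℓ₂ : ℝ) (u : ℝ × ℝ) {ι : Type} [Fintype ι] [DecidableEq ι]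
    (x : ι → ℝ × ℝ) : ℝ :=
  (1 / 2) * Real.log (2 * Real.pi * Real.exp 1 * postVar σs σn ℓ₁ ℓ₂ u x)

/-- The candidate location in row `m` of column `j` of the transect grid. -/
noncomputable def loc (ω₁ ω₂ : ℝ) (j m : ℕ) : ℝ × ℝ := ((j : ℝ) * ω₁, (m : ℝ) * ω₂)

/-- The history of sampled locations over columns 0..i induced by the row choices `c`. -/
noncomputable def hist (ω₁ ω₂ : ℝ) {r : ℕ} (c : ℕ → Fin r) (i : ℕ) : Fin (i + 1) → ℝ × ℝ :=
  fun j => loc ω₁ ω₂ (j : ℕ) ((c (j : ℕ) : ℕ) + 1)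

/-- The quadratic form `kᵀ K⁻¹ k` is the maximum over `w` of `2 wᵀ k - wᵀ K w`. -/
theorem isGreatest_inv_quadForm {ι : Type} [Fintype ι] [DecidableEq ι]
    {K : Matrix ι ι ℝ} (hK : K.PosDef) (k : ι → ℝ) :
    IsGreatest (Set.range fun w : ι → ℝ => 2 * ∑ j, w j * k j - ∑ j, ∑ l, w j * K j l * w l)
      (∑ j, ∑ l, k j * K⁻¹ j l * k l) := by
  have quad (A : Matrix ι ι ℝ) (v w : ι → ℝ) :
      ∑ j, ∑ l, v j * A j l * w l = v ⬝ᵥ A.mulVec w := by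
    simp only [dotProduct, Matrix.mulVec, Finset.mul_sum, mul_assoc]
  have hdet : IsUnit K.det := hK.det_pos.ne'.isUnit
  have hKw : K.mulVec (K⁻¹.mulVec k) = k := by
    rw [Matrix.mulVec_mulVec, Matrix.mul_nonsing_inv K hdet, Matrix.one_mulVec]
  have hsymm (v w : ι → ℝ) : v ⬝ᵥ K.mulVec w = w ⬝ᵥ K.mulVec v := by
    have hT : K.transpose = K := by simpa using hK.isHermitian.eq
    rw [Matrix.dotProduct_mulVec, ← Matrix.mulVec_transpose, hT, dotProduct_comm]
  constructor
  · refine ⟨K⁻¹.mulVec k, ?_⟩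
    beta_reduce
    rw [quad, quad, hKw]
    change 2 * (K⁻¹.mulVec k ⬝ᵥ k) - _ = _
    rw [dotProduct_comm]
    ring
  · rintro _ ⟨w, rfl⟩
    beta_reduce
    rw [quad, quad]
    change 2 * (w ⬝ᵥ k) - _ ≤ _
    have hnonneg := hK.posSemidef.dotProduct_mulVec_nonneg (w - K⁻¹.mulVec k)
    simp only [star_trivial, Matrix.mulVec_sub, hKw, sub_dotProduct, dotProduct_sub] at hnonneg
    have hcross := hsymm (K⁻¹.mulVec k) w
    rw [hKw] at hcross
    have hcomm := dotProduct_comm (K⁻¹.mulVec k) k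
    linarith

/-- A diagonally dominant quadratic form is bounded below by a multiple of the square norm. -/
theorem le_quadForm_of_offDiag_le {n : ℕ} (K : Matrix (Fin n) (Fin n) ℝ) {a b : ℝ}
    (hdiag : ∀ j, K j j = a) (hoff : ∀ j l, j ≠ l → |K j l| ≤ b) (w : Fin n → ℝ) :
    (a + b - n * b) * ∑ j, w j ^ 2 ≤ ∑ j, ∑ l, w j * K j l * w l := by
  have hentry (j l : Fin n) :
      (if j = l then (a + b) * w j ^ 2 else 0) - b / 2 * w j ^ 2 - b / 2 * w l ^ 2 ≤
        w j * K j l * w l := by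
    split_ifs with h
    · subst h
      rw [hdiag]
      linarith
    · obtain ⟨h₁, h₂⟩ := abs_le.mp (hoff j l h)
      nlinarith [mul_nonneg (by linarith : 0 ≤ b + K j l) (sq_nonneg (w j + w l)),
        mul_nonneg (by linarith : 0 ≤ b - K j l) (sq_nonneg (w j - w l))]
  refine le_trans (le_of_eq ?_)
    (Finset.sum_le_sum fun j _ => Finset.sum_le_sum fun l _ => hentry j l)
  simp only [Finset.sum_sub_distrib, Finset.sum_ite_eq, Finset.mem_univ, if_true,
    Finset.sum_const, Finset.card_univ, Fintype.card_fin, nsmul_eq_mul, ← Finset.mul_sum]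
  ring

/-- Adding observations to the last one lowers the conditional variance, and by at most
`n β² / μ`, where `β` bounds the conditional covariances and `μ` the kernel from below. -/
theorem inv_quadForm_last_bounds {n : ℕ} {K : Matrix (Fin (n + 1)) (Fin (n + 1)) ℝ}
    (hK : K.PosDef) (k : Fin (n + 1) → ℝ) {β μ : ℝ} (hμ : 0 < μ)
    (hquad : ∀ w : Fin (n + 1) → ℝ, μ * ∑ j, w j ^ 2 ≤ ∑ j, ∑ l, w j * K j l * w l)
    (hβ : ∀ j : Fin n, |k j.castSucc -
      k (Fin.last n) / K (Fin.last n) (Fin.last n) * K (Fin.last n) j.castSucc| ≤ β) :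
    k (Fin.last n) ^ 2 / K (Fin.last n) (Fin.last n) ≤ ∑ j, ∑ l, k j * K⁻¹ j l * k l ∧
    ∑ j, ∑ l, k j * K⁻¹ j l * k l ≤
      k (Fin.last n) ^ 2 / K (Fin.last n) (Fin.last n) + n * (β ^ 2 / μ) := by
  obtain ⟨⟨w, hw⟩, hmax⟩ := isGreatest_inv_quadForm hK k
  have hpos : 0 < K (Fin.last n) (Fin.last n) := hK.diag_pos
  have hsymm (j l) : K j l = K l j := by simpa using hK.isHermitian.apply l j
  set κ := K (Fin.last n) (Fin.last n) with hκ
  set y := k (Fin.last n) with hy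
  set α := y / κ with hα
  have hακ : α * κ = y := div_mul_cancel₀ y hpos.ne'
  have hyα : y ^ 2 / κ = α * y := by rw [hα]; ring
  constructor
  · refine le_trans (le_of_eq ?_)
      (hmax (Set.mem_range_self (fun j => if j = Fin.last n then α else 0)))
    simp only [ite_mul, zero_mul, mul_ite, mul_zero, Finset.sum_ite_eq', Finset.mem_univ, if_true,
      ← hκ, ← hy, hyα, hακ]
    ring
  · have hq := hquad (fun j => if j = Fin.last n then w j - α else w j)
    simp only [Fin.sum_univ_castSucc, Fin.castSucc_ne_last, if_true, if_false, ← hκ] at hq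
    rw [← hw]
    simp only [Fin.sum_univ_castSucc, ← hκ, ← hy]
    have hterm (j : Fin n) : 2 * w j.castSucc * (k j.castSucc - α * K (Fin.last n) j.castSucc) -
        μ * w j.castSucc ^ 2 ≤ β ^ 2 / μ := by
      rw [le_div_iff₀ hμ]
      have hsq := sq_le_sq' (abs_le.mp (hβ j)).1 (abs_le.mp (hβ j)).2
      nlinarith [sq_nonneg (μ * w j.castSucc - (k j.castSucc - α * K (Fin.last n) j.castSucc))]
    have hsum := Finset.sum_le_sum fun j (_ : j ∈ Finset.univ) => hterm j
    simp only [Finset.sum_const, Finset.card_univ, Fintype.card_fin, nsmul_eq_mul,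
      Finset.sum_sub_distrib, mul_sub, ← Finset.mul_sum] at hsum
    have hcol : ∑ j : Fin n, w j.castSucc * K j.castSucc (Fin.last n) =
        ∑ j : Fin n, w j.castSucc * K (Fin.last n) j.castSucc :=
      Finset.sum_congr rfl fun j _ => by rw [hsymm]
    set S := ∑ j : Fin n, w j.castSucc * K (Fin.last n) j.castSucc with hS
    set T := ∑ j : Fin n, w j.castSucc * k j.castSucc with hT
    have e₁ : ∑ j : Fin n, 2 * w j.castSucc * k j.castSucc = 2 * T := by
      rw [hT, Finset.mul_sum]
      exact Finset.sum_congr rfl fun j _ => by ring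
    have e₂ : ∑ j : Fin n, 2 * w j.castSucc * (α * K (Fin.last n) j.castSucc) = 2 * α * S := by
      rw [hS, Finset.mul_sum]
      exact Finset.sum_congr rfl fun j _ => by ring
    have e₃ (x : ℝ) : ∑ j : Fin n, x * K (Fin.last n) j.castSucc * w j.castSucc = x * S := by
      rw [hS, Finset.mul_sum]
      exact Finset.sum_congr rfl fun j _ => by ring
    rw [e₁, e₂] at hsum
    simp only [Finset.sum_add_distrib, ← Finset.sum_mul, hcol, e₃] at hq ⊢
    rw [hyα]
    nlinarith [mul_nonneg hμ.le (sq_nonneg (w (Fin.last n) - α)),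
      congrArg (· * w (Fin.last n)) hακ, congrArg (· * α) hακ]

theorem seCov_self (σs σn ℓ₁ ℓ₂ : ℝ) (u : ℝ × ℝ) :
    seCov σs σn ℓ₁ ℓ₂ u u = σs ^ 2 + σn ^ 2 := by
  simp [seCov]

theorem seCov_comm (σs σn ℓ₁ ℓ₂ : ℝ) (u v : ℝ × ℝ) :
    seCov σs σn ℓ₁ ℓ₂ u v = seCov σs σn ℓ₁ ℓ₂ v u := by
  simp only [seCov, eq_comm (a := u), sub_sq_comm u.1, sub_sq_comm u.2]

theorem seCov_nonneg (σs σn ℓ₁ ℓ₂ : ℝ) (u v : ℝ × ℝ) : 0 ≤ seCov σs σn ℓ₁ ℓ₂ u v := by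
  unfold seCov
  split_ifs <;> positivity

theorem loc_ne_loc {ω₁ : ℝ} (hω₁ : 0 < ω₁) (ω₂ : ℝ) {a c : ℕ} (h : a ≠ c) (b d : ℕ) :
    loc ω₁ ω₂ a b ≠ loc ω₁ ω₂ c d := fun heq =>
  h (Nat.cast_injective (mul_right_cancel₀ hω₁.ne' (congrArg Prod.fst heq)))

/-- Covariance between locations whose columns are at least `n` apart. -/
theorem seCov_loc_le (σs σn ℓ₁ ℓ₂ : ℝ) {ω₁ : ℝ} (hω₁ : 0 < ω₁) (ω₂ : ℝ) {a c n : ℕ}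
    (hn : n ≠ 0) (h : a + n ≤ c) (b d : ℕ) :
    seCov σs σn ℓ₁ ℓ₂ (loc ω₁ ω₂ a b) (loc ω₁ ω₂ c d) ≤
      σs ^ 2 * Real.exp (-ω₁ ^ 2 / (2 * ℓ₁ ^ 2)) ^ n := by
  have hac : a ≠ c := by lia
  rw [seCov, if_neg (loc_ne_loc hω₁ ω₂ hac b d), mul_zero, add_zero, ← Real.exp_nat_mul]
  gcongr
  have hsq : (n : ℝ) ≤ ((a : ℝ) - c) ^ 2 := by
    have h1 : (1 : ℝ) ≤ n := by exact_mod_cast Nat.one_le_iff_ne_zero.mpr hn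
    have h2 : (a : ℝ) + n ≤ c := by exact_mod_cast h
    nlinarith
  have hvert : 0 ≤ ((loc ω₁ ω₂ a b).2 - (loc ω₁ ω₂ c d).2) ^ 2 / (2 * ℓ₂ ^ 2) := by positivity
  have hhor : -((loc ω₁ ω₂ a b).1 - (loc ω₁ ω₂ c d).1) ^ 2 / (2 * ℓ₁ ^ 2) =
      -(((a : ℝ) - c) ^ 2 * (ω₁ ^ 2 / (2 * ℓ₁ ^ 2))) := by
    simp only [loc]
    ring
  have hmul : (n : ℝ) * (ω₁ ^ 2 / (2 * ℓ₁ ^ 2)) ≤ ((a : ℝ) - c) ^ 2 * (ω₁ ^ 2 / (2 * ℓ₁ ^ 2)) := by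
    gcongr
  rw [hhor, neg_div, mul_neg]
  linarith

theorem postVar_singleton (σs σn ℓ₁ ℓ₂ : ℝ) (u y : ℝ × ℝ) :
    postVar σs σn ℓ₁ ℓ₂ u (fun _ : Fin 1 => y) =
      σs ^ 2 + σn ^ 2 - seCov σs σn ℓ₁ ℓ₂ u y ^ 2 / (σs ^ 2 + σn ^ 2) := by
  simp only [postVar, Finset.univ_unique, Finset.sum_singleton, Matrix.inv_subsingleton,
    Matrix.diagonal_apply_eq, Ring.inverse_eq_inv, kerMat, Matrix.of_apply, seCov_self,
    seCov_comm σs σn ℓ₁ ℓ₂ y u]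
  ring

theorem hist_injective {ω₁ : ℝ} (hω₁ : 0 < ω₁) (ω₂ : ℝ) {r : ℕ} (c : ℕ → Fin r) (i : ℕ) :
    Function.Injective (hist ω₁ ω₂ c i) := fun p q h => by
  by_contra hpq
  exact loc_ne_loc hω₁ ω₂ (fun hv => hpq (Fin.ext hv)) _ _ h

theorem hist_zero (ω₁ ω₂ : ℝ) {r : ℕ} (c : ℕ → Fin r) :
    hist ω₁ ω₂ c 0 = fun _ : Fin 1 => loc ω₁ ω₂ 0 ((c 0 : ℕ) + 1) := by
  funext j
  fin_cases j
  rfl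

/-- Comparison of the posterior variance given the whole history with the one given only the
latest location. -/
theorem postVar_hist_bounds {σs σn ℓ₁ ℓ₂ ω₁ ω₂ ξ ρ : ℝ} (hσs : 0 < σs) (hσn : 0 < σn)
    (hω₁ : 0 < ω₁) (hξ : ξ = Real.exp (-ω₁ ^ 2 / (2 * ℓ₁ ^ 2)))
    (hρ : ρ = 1 + σn ^ 2 / σs ^ 2) {r i : ℕ} (hi : 0 < i) (c : ℕ → Fin r)
    (hPD : (kerMat σs σn ℓ₁ ℓ₂ (hist ω₁ ω₂ c i)).PosDef) (hξρ : ξ < ρ / i) (m : ℕ) :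
    postVar σs σn ℓ₁ ℓ₂ (loc ω₁ ω₂ (i + 1) m) (hist ω₁ ω₂ c i) ≤
      postVar σs σn ℓ₁ ℓ₂ (loc ω₁ ω₂ (i + 1) m)
        (fun _ : Fin 1 => loc ω₁ ω₂ i ((c i : ℕ) + 1)) ∧
    postVar σs σn ℓ₁ ℓ₂ (loc ω₁ ω₂ (i + 1) m)
        (fun _ : Fin 1 => loc ω₁ ω₂ i ((c i : ℕ) + 1)) - σs ^ 2 * (ξ ^ 4 / (ρ / i - ξ)) ≤
      postVar σs σn ℓ₁ ℓ₂ (loc ω₁ ω₂ (i + 1) m) (hist ω₁ ω₂ c i) := by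
  have hs : 0 < σs ^ 2 := by positivity
  have hsρ : σs ^ 2 + σn ^ 2 = σs ^ 2 * ρ := by rw [hρ]; field_simp
  have hρ1 : 1 ≤ ρ := by
    rw [hρ, le_add_iff_nonneg_right]
    positivity
  have hξ0 : 0 < ξ := hξ ▸ Real.exp_pos _
  have hi0 : (0 : ℝ) < i := by exact_mod_cast hi
  have hcov {n a e : ℕ} (hn : n ≠ 0) (h : a + n ≤ e) (b d : ℕ) :
      seCov σs σn ℓ₁ ℓ₂ (loc ω₁ ω₂ a b) (loc ω₁ ω₂ e d) ≤ σs ^ 2 * ξ ^ n :=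
    hξ ▸ seCov_loc_le σs σn ℓ₁ ℓ₂ hω₁ ω₂ hn h b d
  have hcov_succ {a e : ℕ} (h : a < e) (b d : ℕ) :
      seCov σs σn ℓ₁ ℓ₂ (loc ω₁ ω₂ a b) (loc ω₁ ω₂ e d) ≤ σs ^ 2 * ξ := by
    simpa using hcov one_ne_zero (Nat.succ_le_of_lt h) b d
  have hlam : 0 < ρ - i * ξ := by
    have := (lt_div_iff₀ hi0).mp hξρ
    linarith
  set u := loc ω₁ ω₂ (i + 1) m with hu
  set x := hist ω₁ ω₂ c i with hx
  have hlast : x (Fin.last i) = loc ω₁ ω₂ i ((c i : ℕ) + 1) := rfl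
  have hquad (w : Fin (i + 1) → ℝ) : σs ^ 2 * (ρ - i * ξ) * ∑ j, w j ^ 2 ≤
      ∑ j, ∑ l, w j * kerMat σs σn ℓ₁ ℓ₂ x j l * w l := by
    refine le_trans (le_of_eq ?_) (le_quadForm_of_offDiag_le (a := σs ^ 2 * ρ) (b := σs ^ 2 * ξ)
      (kerMat σs σn ℓ₁ ℓ₂ x) (fun j => ?_) (fun j l hjl => ?_) w)
    · push_cast
      ring
    · rw [kerMat, Matrix.of_apply, seCov_self, hsρ]
    · rw [kerMat, Matrix.of_apply, abs_of_nonneg (seCov_nonneg ..)]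
      rcases lt_or_gt_of_ne hjl with h | h
      · exact hcov_succ h _ _
      · rw [seCov_comm]
        exact hcov_succ h _ _
  have huy : seCov σs σn ℓ₁ ℓ₂ u (x (Fin.last i)) ≤ σs ^ 2 * ξ := by
    rw [seCov_comm]
    exact hcov_succ (Nat.lt_succ_self i) _ _
  have hβ (j : Fin i) : |seCov σs σn ℓ₁ ℓ₂ u (x j.castSucc) -
      seCov σs σn ℓ₁ ℓ₂ u (x (Fin.last i)) /
        kerMat σs σn ℓ₁ ℓ₂ x (Fin.last i) (Fin.last i) *
        kerMat σs σn ℓ₁ ℓ₂ x (Fin.last i) j.castSucc| ≤ σs ^ 2 * ξ ^ 2 := by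
    simp only [kerMat, Matrix.of_apply, seCov_self, hsρ]
    have hux : seCov σs σn ℓ₁ ℓ₂ u (x j.castSucc) ≤ σs ^ 2 * ξ ^ 2 := by
      rw [seCov_comm]
      refine hcov two_ne_zero ?_ _ _
      have := j.isLt
      simp only [Fin.val_castSucc]
      lia
    have hyx : seCov σs σn ℓ₁ ℓ₂ (x (Fin.last i)) (x j.castSucc) ≤ σs ^ 2 * ξ := by
      rw [seCov_comm]
      exact hcov_succ j.isLt _ _
    have h₁ := seCov_nonneg σs σn ℓ₁ ℓ₂ u (x j.castSucc)
    have h₂ := seCov_nonneg σs σn ℓ₁ ℓ₂ u (x (Fin.last i))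
    have h₃ := seCov_nonneg σs σn ℓ₁ ℓ₂ (x (Fin.last i)) (x j.castSucc)
    have hratio : seCov σs σn ℓ₁ ℓ₂ u (x (Fin.last i)) / (σs ^ 2 * ρ) ≤ ξ := by
      rw [div_le_iff₀ (by positivity)]
      nlinarith [mul_pos hs hξ0]
    have hprod := mul_le_mul hratio hyx h₃ hξ0.le
    have hprod0 := mul_nonneg (div_nonneg h₂ (by positivity : 0 ≤ σs ^ 2 * ρ)) h₃
    rw [abs_le]
    constructor <;> nlinarith
  obtain ⟨hlow, hupp⟩ := inv_quadForm_last_bounds hPD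
    (fun j => seCov σs σn ℓ₁ ℓ₂ u (x j)) (mul_pos hs hlam) hquad hβ
  have hgain : (i : ℝ) * ((σs ^ 2 * ξ ^ 2) ^ 2 / (σs ^ 2 * (ρ - i * ξ))) =
      σs ^ 2 * (ξ ^ 4 / (ρ / i - ξ)) := by
    have : ρ / i - ξ = (ρ - i * ξ) / i := by field_simp
    rw [this]
    field_simp
  have hdiag : kerMat σs σn ℓ₁ ℓ₂ x (Fin.last i) (Fin.last i) = σs ^ 2 + σn ^ 2 := by
    rw [kerMat, Matrix.of_apply, seCov_self]
  rw [hgain] at hupp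
  simp only [hdiag, hlast] at hlow hupp
  rw [postVar_singleton, postVar, seCov_self]
  simp only [seCov_comm σs σn ℓ₁ ℓ₂ _ u]
  constructor <;> linarith

/-- Conditioning only on the latest location overestimates the stagewise entropy by an amount
between `0` and `Del ξ ρ i`. -/
theorem ent_hist_bounds {σs σn ℓ₁ ℓ₂ ω₁ ω₂ ξ ρ : ℝ} (hσs : 0 < σs) (hσn : 0 < σn)
    (hω₁ : 0 < ω₁) (hξ : ξ = Real.exp (-ω₁ ^ 2 / (2 * ℓ₁ ^ 2)))
    (hρ : ρ = 1 + σn ^ 2 / σs ^ 2) {r i t : ℕ} (hit : i ≤ t) (c : ℕ → Fin r)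
    (hPD : (kerMat σs σn ℓ₁ ℓ₂ (hist ω₁ ω₂ c i)).PosDef) (hξρ : ξ < ρ / t)
    (hξ4 : ξ ^ 4 < (ρ / t - ξ) * (ρ - ξ ^ 2)) (m : ℕ) :
    ent σs σn ℓ₁ ℓ₂ (loc ω₁ ω₂ (i + 1) m) (hist ω₁ ω₂ c i) ≤
      ent σs σn ℓ₁ ℓ₂ (loc ω₁ ω₂ (i + 1) m)
        (fun _ : Fin 1 => loc ω₁ ω₂ i ((c i : ℕ) + 1)) ∧
    ent σs σn ℓ₁ ℓ₂ (loc ω₁ ω₂ (i + 1) m)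
        (fun _ : Fin 1 => loc ω₁ ω₂ i ((c i : ℕ) + 1)) ≤
      ent σs σn ℓ₁ ℓ₂ (loc ω₁ ω₂ (i + 1) m) (hist ω₁ ω₂ c i) + Del ξ ρ i := by
  rcases Nat.eq_zero_or_pos i with rfl | hi
  · simp [hist_zero, Del]
  have hs : 0 < σs ^ 2 := by positivity
  have hsρ : σs ^ 2 + σn ^ 2 = σs ^ 2 * ρ := by rw [hρ]; field_simp
  have hρ1 : 1 < ρ := by
    rw [hρ, lt_add_iff_pos_right]
    positivity
  have hξ0 : 0 < ξ := hξ ▸ Real.exp_pos _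
  have hi0 : (0 : ℝ) < i := by exact_mod_cast hi
  have hρit : ρ / t ≤ ρ / i := by
    have : (i : ℝ) ≤ t := by exact_mod_cast hit
    gcongr
  have hgap : 0 < ρ / i - ξ := by linarith
  have hρξ : 0 < ρ - ξ ^ 2 :=
    pos_of_mul_pos_right (lt_trans (by positivity) hξ4) (by linarith)
  have hξ4i : ξ ^ 4 < (ρ / i - ξ) * (ρ - ξ ^ 2) :=
    hξ4.trans_le (mul_le_mul_of_nonneg_right (by linarith) hρξ.le)
  obtain ⟨hupp, hlow⟩ := postVar_hist_bounds hσs hσn hω₁ hξ hρ hi c hPD (hξρ.trans_le hρit) m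
  have hMarkov : σs ^ 2 * (ρ - ξ ^ 2) ≤ postVar σs σn ℓ₁ ℓ₂ (loc ω₁ ω₂ (i + 1) m)
      (fun _ : Fin 1 => loc ω₁ ω₂ i ((c i : ℕ) + 1)) := by
    have hcov : seCov σs σn ℓ₁ ℓ₂ (loc ω₁ ω₂ (i + 1) m) (loc ω₁ ω₂ i ((c i : ℕ) + 1)) ≤
        σs ^ 2 * ξ := by
      rw [seCov_comm]
      simpa [hξ] using seCov_loc_le σs σn ℓ₁ ℓ₂ hω₁ ω₂ one_ne_zero (le_refl (i + 1)) _ m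
    have hsq := pow_le_pow_left₀ (seCov_nonneg ..) hcov 2
    rw [postVar_singleton, hsρ]
    have : seCov σs σn ℓ₁ ℓ₂ (loc ω₁ ω₂ (i + 1) m) (loc ω₁ ω₂ i ((c i : ℕ) + 1)) ^ 2 /
        (σs ^ 2 * ρ) ≤ σs ^ 2 * ξ ^ 2 := by
      rw [div_le_iff₀ (by positivity)]
      refine hsq.trans ?_
      have : 0 ≤ (σs ^ 2 * ξ) ^ 2 * (ρ - 1) := mul_nonneg (sq_nonneg _) (by linarith)
      linarith
    linarith
  simp only [ent, Del, if_neg hi.ne']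
  set p := postVar σs σn ℓ₁ ℓ₂ (loc ω₁ ω₂ (i + 1) m)
    (fun _ : Fin 1 => loc ω₁ ω₂ i ((c i : ℕ) + 1)) with hp
  set q := postVar σs σn ℓ₁ ℓ₂ (loc ω₁ ω₂ (i + 1) m) (hist ω₁ ω₂ c i) with hq
  have hp0 : 0 < p := lt_of_lt_of_le (mul_pos hs hρξ) hMarkov
  set D := 1 - ξ ^ 4 / ((ρ / i - ξ) * (ρ - ξ ^ 2)) with hD
  have hD0 : 0 < D := by
    rw [hD, sub_pos, div_lt_one (mul_pos hgap hρξ)]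
    exact hξ4i
  have hDq : p * D ≤ q := by
    refine le_trans ?_ hlow
    have hloss : σs ^ 2 * (ξ ^ 4 / (ρ / i - ξ)) =
        σs ^ 2 * (ρ - ξ ^ 2) * (ξ ^ 4 / ((ρ / i - ξ) * (ρ - ξ ^ 2))) := by
      field_simp
    rw [hloss, hD, mul_sub, mul_one]
    exact sub_le_sub_left (mul_le_mul_of_nonneg_right hMarkov
      (div_nonneg (by positivity) (mul_pos hgap hρξ).le)) p
  have hq0 : 0 < q := lt_of_lt_of_le (mul_pos hp0 hD0) hDq
  have hC : 0 < 2 * Real.pi * Real.exp 1 := by positivity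
  constructor
  · gcongr
  · have hlog : Real.log (2 * Real.pi * Real.exp 1 * p) + Real.log D ≤
        Real.log (2 * Real.pi * Real.exp 1 * q) := by
      rw [← Real.log_mul (mul_pos hC hp0).ne' hD0.ne']
      refine Real.log_le_log (by positivity) ?_
      rw [mul_assoc]
      exact mul_le_mul_of_nonneg_left hDq hC.le
    rw [Real.log_inv]
    linarith

theorem stmt_8 (σs σn ℓ₁ ℓ₂ ω₁ ω₂ ξ ρ : ℝ)
    (hσs : 0 < σs) (hσn : 0 < σn) (hℓ₁ : 0 < ℓ₁) (hℓ₂ : 0 < ℓ₂)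
    (hω₁ : 0 < ω₁) (hω₂ : 0 < ω₂)
    (hξ : ξ = Real.exp (-ω₁ ^ 2 / (2 * ℓ₁ ^ 2)))
    (hρ : ρ = 1 + σn ^ 2 / σs ^ 2)
    (t r : ℕ) (ht : 1 ≤ t) (hr : 1 ≤ r)
    (hPD : ∀ (n : ℕ) (z : Fin n → ℝ × ℝ),
      (∀ p, ∃ a b : ℕ, z p = loc ω₁ ω₂ a b) → Function.Injective z →
        (kerMat σs σn ℓ₁ ℓ₂ z).PosDef)
    (hξρ : ξ < ρ / t) (hξ4 : ξ ^ 4 < (ρ / t - ξ) * (ρ - ξ ^ 2))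
    -- Markov value functions Ṽ_i on column-i candidate locations
    (Vtil : ℕ → ℝ × ℝ → ℝ)
    (hVtilT : ∀ m : Fin r,
      Vtil t (loc ω₁ ω₂ t ((m : ℕ) + 1)) = ⨆ a : Fin r,
        ent σs σn ℓ₁ ℓ₂ (loc ω₁ ω₂ (t + 1) ((a : ℕ) + 1))
          (fun _ : Fin 1 => loc ω₁ ω₂ t ((m : ℕ) + 1)))
    (hVtilI : ∀ i < t, ∀ m : Fin r,
      Vtil i (loc ω₁ ω₂ i ((m : ℕ) + 1)) = ⨆ a : Fin r,
        (ent σs σn ℓ₁ ℓ₂ (loc ω₁ ω₂ (i + 1) ((a : ℕ) + 1))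
            (fun _ : Fin 1 => loc ω₁ ω₂ i ((m : ℕ) + 1)) +
          Vtil (i + 1) (loc ω₁ ω₂ (i + 1) ((a : ℕ) + 1))))
    -- non-Markovian optimal value functions V*_i on histories
    (Vstar : ℕ → (ℕ → Fin r) → ℝ)
    (hVstarT : ∀ c : ℕ → Fin r,
      Vstar t c = ⨆ a : Fin r,
        ent σs σn ℓ₁ ℓ₂ (loc ω₁ ω₂ (t + 1) ((a : ℕ) + 1)) (hist ω₁ ω₂ c t))
    (hVstarI : ∀ i < t, ∀ c : ℕ → Fin r,
      Vstar i c = ⨆ a : Fin r,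
        (ent σs σn ℓ₁ ℓ₂ (loc ω₁ ω₂ (i + 1) ((a : ℕ) + 1)) (hist ω₁ ω₂ c i) +
          Vstar (i + 1) (Function.update c (i + 1) a)))
    -- a Markov-optimal policy π̃: it attains the maximum in the recursion defining Ṽ
    (pol : ℕ → ℝ × ℝ → Fin r)
    (hpolT : ∀ m : Fin r,
      ent σs σn ℓ₁ ℓ₂ (loc ω₁ ω₂ (t + 1) ((pol t (loc ω₁ ω₂ t ((m : ℕ) + 1)) : ℕ) + 1))
          (fun _ : Fin 1 => loc ω₁ ω₂ t ((m : ℕ) + 1)) =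
        Vtil t (loc ω₁ ω₂ t ((m : ℕ) + 1)))
    (hpolI : ∀ i < t, ∀ m : Fin r,
      ent σs σn ℓ₁ ℓ₂ (loc ω₁ ω₂ (i + 1) ((pol i (loc ω₁ ω₂ i ((m : ℕ) + 1)) : ℕ) + 1))
          (fun _ : Fin 1 => loc ω₁ ω₂ i ((m : ℕ) + 1)) +
        Vtil (i + 1) (loc ω₁ ω₂ (i + 1) ((pol i (loc ω₁ ω₂ i ((m : ℕ) + 1)) : ℕ) + 1)) =
        Vtil i (loc ω₁ ω₂ i ((m : ℕ) + 1)))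
    -- the non-Markovian value V^{π̃}_i of following π̃
    (Vpi : ℕ → (ℕ → Fin r) → ℝ)
    (hVpiT : ∀ c : ℕ → Fin r,
      Vpi t c = ent σs σn ℓ₁ ℓ₂
        (loc ω₁ ω₂ (t + 1) ((pol t (loc ω₁ ω₂ t ((c t : ℕ) + 1)) : ℕ) + 1)) (hist ω₁ ω₂ c t))
    (hVpiI : ∀ i < t, ∀ c : ℕ → Fin r,
      Vpi i c = ent σs σn ℓ₁ ℓ₂
          (loc ω₁ ω₂ (i + 1) ((pol i (loc ω₁ ω₂ i ((c i : ℕ) + 1)) : ℕ) + 1)) (hist ω₁ ω₂ c i) +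
        Vpi (i + 1) (Function.update c (i + 1) (pol i (loc ω₁ ω₂ i ((c i : ℕ) + 1))))) :
    ∀ c : ℕ → Fin r, Vstar 0 c - Vpi 0 c ≤ ∑ s ∈ Finset.Icc 0 t, Del ξ ρ s := by
  intro c₀
  have : Nonempty (Fin r) := ⟨⟨0, hr⟩⟩
  have hstage (i : ℕ) (hit : i ≤ t) (c : ℕ → Fin r) (m : ℕ) :=
    ent_hist_bounds hσs hσn hω₁ hξ hρ hit c
      (hPD (i + 1) (hist ω₁ ω₂ c i) (fun p => ⟨_, _, rfl⟩) (hist_injective hω₁ ω₂ c i)) hξρ hξ4 m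
  have hstar : ∀ k i, i + k = t → ∀ c : ℕ → Fin r,
      Vstar i c ≤ Vtil i (loc ω₁ ω₂ i ((c i : ℕ) + 1)) := by
    intro k
    induction k with
    | zero =>
      rintro i rfl c
      rw [add_zero] at *
      rw [hVstarT, hVtilT]
      exact ciSup_mono (Set.finite_range _).bddAbove fun a => (hstage i le_rfl c _).1
    | succ k ih =>
      intro i hik c
      rw [hVstarI i (by lia), hVtilI i (by lia)]
      refine ciSup_mono (Set.finite_range _).bddAbove fun a => ?_
      have hnext := ih (i + 1) (by lia) (Function.update c (i + 1) a)
      rw [Function.update_self] at hnext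
      exact add_le_add (hstage i (by lia) c _).1 hnext
  have hpi : ∀ k i, i + k = t → ∀ c : ℕ → Fin r,
      Vtil i (loc ω₁ ω₂ i ((c i : ℕ) + 1)) ≤ Vpi i c + ∑ s ∈ Finset.Icc i t, Del ξ ρ s := by
    intro k
    induction k with
    | zero =>
      rintro i rfl c
      rw [add_zero] at *
      rw [hVpiT, ← hpolT, Finset.Icc_self, Finset.sum_singleton]
      exact (hstage i le_rfl c _).2
    | succ k ih =>
      intro i hik c
      have hnext := ih (i + 1) (by lia)
        (Function.update c (i + 1) (pol i (loc ω₁ ω₂ i ((c i : ℕ) + 1))))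
      rw [Function.update_self] at hnext
      rw [hVpiI i (by lia), ← hpolI i (by lia),
        ← Finset.add_sum_Ioc_eq_sum_Icc (by lia : i ≤ t), ← Finset.Icc_add_one_left_eq_Ioc]
      have := (hstage i (by lia) c ((pol i (loc ω₁ ω₂ i ((c i : ℕ) + 1)) : ℕ) + 1)).2
      linarith
  have h₁ := hstar t 0 (zero_add t) c₀
  have h₂ := hpi t 0 (zero_add t) c₀
  linarith
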